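/- Let n ≥ 1, 0 < s < 1, and let u and φ be complex-valued Schwartz functions on ℝⁿ×ℝ. Then ∫_ℝ ∫_{ℝⁿ} ((∂_t−Δ)^s u)(x,t) · conj(φ(x,t)) dx dt = ∫_ℝ ∫_{ℝⁿ} u(x,t) · conj((∂_t−Δ)^s_{right} φ(x,t)) dx dt, where both integrals converge absolutely. -/

import Mathlib

open MeasureTheory

/-- `ℝⁿ` as Euclidean space. -/
abbrev En (n : ℕ) := EuclideanSpace ℝ (Fin n)

/-- The normalization constant `C_{n,s} = (4π)^{-n/2} / |Γ(-s)|`. -/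
noncomputable def Cns (n : ℕ) (s : ℝ) : ℝ :=
  (4 * Real.pi) ^ (-(n : ℝ) / 2) / |Real.Gamma (-s)|

/-- The right fractional heat operator `(∂_t - Δ)^s_{right}`. -/
noncomputable def rightHeat (n : ℕ) (s : ℝ) (φ : En n × ℝ → ℂ)
    (x : En n) (t : ℝ) : ℂ :=
  ((Cns n s / 2 : ℝ) : ℂ) *
    ∫ τ in Set.Ioi (0 : ℝ), ∫ y : En n,
      (2 * φ (x, t) - φ (x + y, t + τ) - φ (x - y, t + τ)) *
        (((τ ^ (-((n : ℝ) / 2 + 1 + s)) * Real.exp (-‖y‖ ^ 2 / (4 * τ)) : ℝ)) : ℂ)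

/-- The (left) fully fractional heat operator `(∂_t - Δ)^s`. -/
noncomputable def leftHeat (n : ℕ) (s : ℝ) (u : En n × ℝ → ℂ)
    (x : En n) (t : ℝ) : ℂ :=
  ((Cns n s / 2 : ℝ) : ℂ) *
    ∫ τ in Set.Ioi (0 : ℝ), ∫ y : En n,
      (2 * u (x, t) - u (x + y, t - τ) - u (x - y, t - τ)) *
        (((τ ^ (-((n : ℝ) / 2 + 1 + s)) * Real.exp (-‖y‖ ^ 2 / (4 * τ)) : ℝ)) : ℂ)

namespace SchwartzMap

variable {E F : Type*} [NormedAddCommGroup E] [NormedSpace ℝ E]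
  [NormedAddCommGroup F] [NormedSpace ℝ F]

theorem exists_norm_le (f : SchwartzMap E F) : ∃ C, 0 ≤ C ∧ ∀ x, ‖f x‖ ≤ C := by
  obtain ⟨C, hC, h⟩ := f.decay 0 0
  exact ⟨C, hC.le, fun x => by simpa using h x⟩

theorem exists_norm_fderiv_le (f : SchwartzMap E F) :
    ∃ C, 0 ≤ C ∧ ∀ x, ‖fderiv ℝ f x‖ ≤ C := by
  obtain ⟨C, hC, h⟩ := (fderivCLM ℝ E F f).exists_norm_le
  exact ⟨C, hC, fun x => by simpa using h x⟩

theorem exists_norm_sub_le (f : SchwartzMap E F) :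
    ∃ C, 0 ≤ C ∧ ∀ x y, ‖f x - f y‖ ≤ C * ‖x - y‖ := by
  obtain ⟨C, hC, h⟩ := f.exists_norm_fderiv_le
  exact ⟨C, hC, fun x y => convex_univ.norm_image_sub_le_of_norm_fderiv_le (𝕜 := ℝ)
    (fun z _ => f.differentiableAt) (fun z _ => h z) (Set.mem_univ y) (Set.mem_univ x)⟩

theorem exists_norm_second_difference_le (f : SchwartzMap E F) :
    ∃ C, 0 ≤ C ∧ ∀ x v, ‖f (x + v) + f (x - v) - (2 : ℝ) • f x‖ ≤ C * ‖v‖ ^ 2 := by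
  obtain ⟨C, hC, h⟩ := (fderivCLM ℝ E F f).exists_norm_sub_le
  simp only [fderivCLM_apply] at h
  refine ⟨2 * C, by positivity, fun x v => ?_⟩
  have hd : ∀ w : E, HasFDerivAt (fun w => f (x + w) + f (x - w))
      (fderiv ℝ f (x + w) - fderiv ℝ f (x - w)) w := by
    intro w
    have h1 := (f.differentiableAt (x := x + w)).hasFDerivAt.comp w
      ((hasFDerivAt_id w).const_add x)
    have h2 := (f.differentiableAt (x := x - w)).hasFDerivAt.comp w
      ((hasFDerivAt_id w).const_sub x)
    convert! h1.add h2 using 1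
    ext z
    simp [sub_eq_add_neg]
  have hb : ∀ w ∈ Metric.closedBall (0 : E) ‖v‖,
      ‖fderiv ℝ f (x + w) - fderiv ℝ f (x - w)‖ ≤ 2 * C * ‖v‖ := by
    intro w hw
    have hw' : ‖w‖ ≤ ‖v‖ := by simpa using hw
    calc _ ≤ C * ‖(x + w) - (x - w)‖ := h _ _
      _ = C * ‖(2 : ℝ) • w‖ := by congr 2; module
      _ = 2 * C * ‖w‖ := by rw [norm_smul]; norm_num; ring
      _ ≤ _ := by gcongr
  have := (convex_closedBall (0 : E) ‖v‖).norm_image_sub_le_of_norm_hasFDerivWithin_le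
    (fun w _ => (hd w).hasFDerivWithinAt) hb (x := 0) (y := v) (by simp) (by simp)
  calc _ = ‖f (x + v) + f (x - v) - (f (x + 0) + f (x - 0))‖ := by simp [two_smul]
    _ ≤ 2 * C * ‖v‖ * ‖v - 0‖ := this
    _ = _ := by rw [sub_zero]; ring

end SchwartzMap

instance (n : ℕ) : (volume : Measure (En n × ℝ)).IsAddHaarMeasure :=
  inferInstanceAs ((volume : Measure (En n)).prod (volume : Measure ℝ)).IsAddHaarMeasure

theorem integrable_conj_schwartz {n : ℕ} (f : SchwartzMap (En n × ℝ) ℂ) :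
    Integrable (fun p => (starRingEnd ℂ) (f p)) :=
  memLp_one_iff_integrable.1 (memLp_one_iff_integrable.2 f.integrable).star

/-- The unnormalized kernel of the fractional heat operators, at time lag `z.1` and spatial
increment `z.2`. -/
noncomputable def fracHeatKernel (n : ℕ) (s : ℝ) (z : ℝ × En n) : ℝ :=
  z.1 ^ (-((n : ℝ) / 2 + 1 + s)) * Real.exp (-‖z.2‖ ^ 2 / (4 * z.1))

/-- The parabolic second difference `2 f(x,t) - f(x+y,t+στ) - f(x-y,t+στ)`, with `p = (x,t)`
and `z = (τ,y)`. -/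
def heatDifference {n : ℕ} (σ : ℝ) (f : En n × ℝ → ℂ) (p : En n × ℝ) (z : ℝ × En n) : ℂ :=
  2 * f p - f (p.1 + z.2, p.2 + σ * z.1) - f (p.1 - z.2, p.2 + σ * z.1)

/-- The product of the measure `dτ` on `(0,∞)` and Lebesgue measure `dy` on `ℝⁿ`. -/
noncomputable def lagMeasure (n : ℕ) : Measure (ℝ × En n) :=
  (volume.restrict (Set.Ioi (0 : ℝ))).prod volume

instance (n : ℕ) : SFinite (lagMeasure n) := by
  unfold lagMeasure; infer_instance

theorem ae_lagMeasure_pos (n : ℕ) : ∀ᵐ z ∂lagMeasure n, 0 < z.1 :=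
  Measure.quasiMeasurePreserving_fst.ae (ae_restrict_mem measurableSet_Ioi)

theorem exists_norm_heatDifference_le {n : ℕ} (σ : ℝ) (f : SchwartzMap (En n × ℝ) ℂ) :
    ∃ C, 0 ≤ C ∧ ∀ p z, 0 < z.1 →
      ‖heatDifference σ f p z‖ ≤ C * min 1 (‖z.2‖ ^ 2 + z.1) := by
  obtain ⟨A, hA, hf⟩ := f.exists_norm_le
  obtain ⟨B, hB, hl⟩ := f.exists_norm_sub_le
  obtain ⟨D, hD, hs⟩ := f.exists_norm_second_difference_le
  refine ⟨4 * A + (2 * B * |σ| + D), by positivity, fun ⟨x, t⟩ ⟨τ, y⟩ hτ => ?_⟩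
  simp only [heatDifference] at hτ ⊢
  have h1 : ‖2 * f (x, t) - f (x + y, t + σ * τ) - f (x - y, t + σ * τ)‖ ≤ 4 * A := by
    calc _ ≤ ‖2 * f (x, t)‖ + ‖f (x + y, t + σ * τ)‖ + ‖f (x - y, t + σ * τ)‖ :=
          (norm_sub_le _ _).trans (by gcongr; exact norm_sub_le _ _)
      _ ≤ 2 * A + A + A := by
          rw [norm_mul, Complex.norm_ofNat]
          gcongr <;> exact hf _
      _ = _ := by ring
  have h2 : ‖2 * f (x, t) - f (x + y, t + σ * τ) - f (x - y, t + σ * τ)‖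
      ≤ 2 * B * |σ| * τ + D * ‖y‖ ^ 2 := by
    have e1 := hl (x, t) (x, t + σ * τ)
    have e2 := hs (x, t + σ * τ) (y, 0)
    simp only [Prod.mk_add_mk, Prod.mk_sub_mk, add_zero, sub_zero, sub_self, sub_add_cancel_left,
      Prod.norm_mk, norm_zero, norm_neg, norm_mul, Real.norm_eq_abs, abs_of_pos hτ] at e1 e2
    rw [max_eq_right (by positivity)] at e1
    rw [max_eq_left (by positivity)] at e2
    calc _ = ‖2 * (f (x, t) - f (x, t + σ * τ)) - (f (x + y, t + σ * τ) + f (x - y, t + σ * τ)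
            - (2 : ℝ) • f (x, t + σ * τ))‖ := by
          congr 1; simp only [Complex.real_smul]; push_cast; ring
      _ ≤ 2 * ‖f (x, t) - f (x, t + σ * τ)‖ + ‖f (x + y, t + σ * τ) + f (x - y, t + σ * τ)
            - (2 : ℝ) • f (x, t + σ * τ)‖ := (norm_sub_le _ _).trans (by simp)
      _ ≤ 2 * (B * (|σ| * τ)) + D * ‖y‖ ^ 2 := by gcongr
      _ = _ := by ring
  have hm : 0 ≤ ‖y‖ ^ 2 := by positivity
  rcases le_total 1 (‖y‖ ^ 2 + τ) with h | h
  · rw [min_eq_left h]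
    have : 0 ≤ 2 * B * |σ| + D := by positivity
    linarith
  · rw [min_eq_right h]
    refine h2.trans ?_
    have a1 : 0 ≤ 2 * B * |σ| := by positivity
    nlinarith [mul_nonneg a1 hm, mul_nonneg hA hm, mul_nonneg hA hτ.le, mul_nonneg hD hτ.le]

theorem sq_mul_exp_neg_le {τ r : ℝ} (hτ : 0 < τ) :
    r ^ 2 * Real.exp (-r ^ 2 / (4 * τ)) ≤ 8 * τ * Real.exp (-(1 / (8 * τ)) * r ^ 2) := by
  have h := Real.add_one_le_exp (1 / (8 * τ) * r ^ 2)
  have e : Real.exp (-(1 / (8 * τ)) * r ^ 2)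
      = Real.exp (1 / (8 * τ) * r ^ 2) * Real.exp (-r ^ 2 / (4 * τ)) := by
    rw [← Real.exp_add]; congr 1; field_simp; ring
  rw [e, ← mul_assoc]
  gcongr
  calc r ^ 2 = 8 * τ * (1 / (8 * τ) * r ^ 2) := by field_simp
    _ ≤ _ := by gcongr; linarith

theorem integrableOn_min_mul_rpow {s : ℝ} (hs0 : 0 < s) (hs1 : s < 1) :
    IntegrableOn (fun τ : ℝ => min 1 (9 * τ) * τ ^ (-1 - s)) (Set.Ioi 0) := by
  have hm : Measurable (fun τ : ℝ => min 1 (9 * τ) * τ ^ (-1 - s)) := by fun_prop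
  rw [← Set.Ioc_union_Ioi_eq_Ioi zero_le_one]
  refine IntegrableOn.union ?_ ?_
  · have h : IntegrableOn (fun τ : ℝ => 9 * τ ^ (-s)) (Set.Ioc 0 1) :=
      ((intervalIntegrable_iff_integrableOn_Ioc_of_le zero_le_one).1
        (intervalIntegral.intervalIntegrable_rpow' (by linarith))).const_mul 9
    refine h.mono' hm.aestronglyMeasurable ?_
    filter_upwards [ae_restrict_mem measurableSet_Ioc] with τ hτ
    have h0 := hτ.1
    rw [Real.norm_of_nonneg (by positivity)]
    calc _ ≤ 9 * τ * τ ^ (-1 - s) := by gcongr; exact min_le_right _ _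
      _ = 9 * (τ ^ (1 : ℝ) * τ ^ (-1 - s)) := by rw [Real.rpow_one]; ring
      _ = _ := by rw [← Real.rpow_add h0]; ring_nf
  · have h := integrableOn_Ioi_rpow_of_lt (a := -1 - s) (by linarith) one_pos
    refine h.mono' hm.aestronglyMeasurable ?_
    filter_upwards [ae_restrict_mem measurableSet_Ioi] with τ hτ
    have h0 : 0 < τ := one_pos.trans hτ
    rw [Real.norm_of_nonneg (by positivity)]
    exact mul_le_of_le_one_left (by positivity) (min_le_left _ _)

theorem measurable_fracHeatKernel (n : ℕ) (s : ℝ) : Measurable (fracHeatKernel n s) := by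
  unfold fracHeatKernel; fun_prop

theorem integrable_exp_neg_mul_sq_norm (n : ℕ) {b : ℝ} (hb : 0 < b) :
    Integrable (fun y : En n => Real.exp (-b * ‖y‖ ^ 2)) := by
  have := (GaussianFourier.integrable_cexp_neg_mul_sq_norm_add (V := En n) (b := b)
    (by simpa using hb) 0 0).re
  refine this.congr (.of_forall fun y => ?_)
  simp only [zero_mul, add_zero]
  norm_cast

theorem integrable_min_mul_fracHeatKernel (n : ℕ) {s : ℝ} (hs0 : 0 < s) (hs1 : s < 1) :
    Integrable (fun z : ℝ × En n => min 1 (‖z.2‖ ^ 2 + z.1) * fracHeatKernel n s z)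
      (lagMeasure n) := by
  have hdom : Integrable (fun z : ℝ × En n => min 1 (9 * z.1) * z.1 ^ (-((n : ℝ) / 2 + 1 + s)) *
      Real.exp (-(1 / (8 * z.1)) * ‖z.2‖ ^ 2)) (lagMeasure n) := by
    refine (integrable_prod_iff (by fun_prop)).2 ⟨?_, ?_⟩
    · filter_upwards [ae_restrict_mem measurableSet_Ioi] with τ hτ
      have h0 : 0 < τ := hτ
      exact (integrable_exp_neg_mul_sq_norm n (by positivity)).const_mul _
    · refine ((integrableOn_min_mul_rpow hs0 hs1).const_mul
        ((8 * Real.pi) ^ ((n : ℝ) / 2))).congr ?_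
      filter_upwards [ae_restrict_mem measurableSet_Ioi] with τ hτ
      have h0 : 0 < τ := hτ
      have hn : ∀ y : En n, ‖min 1 (9 * τ) * τ ^ (-((n : ℝ) / 2 + 1 + s)) *
          Real.exp (-(1 / (8 * τ)) * ‖y‖ ^ 2)‖ = min 1 (9 * τ) * τ ^ (-((n : ℝ) / 2 + 1 + s)) *
          Real.exp (-(1 / (8 * τ)) * ‖y‖ ^ 2) := fun y => Real.norm_of_nonneg (by positivity)
      simp only [hn]
      rw [integral_const_mul, GaussianFourier.integral_rexp_neg_mul_sq_norm (by positivity),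
        finrank_euclideanSpace_fin]
      have : Real.pi / (1 / (8 * τ)) = 8 * Real.pi * τ := by field_simp
      rw [this, Real.mul_rpow (by positivity) h0.le]
      have e : τ ^ (-1 - s) = τ ^ (-((n : ℝ) / 2 + 1 + s)) * τ ^ ((n : ℝ) / 2) := by
        rw [← Real.rpow_add h0]; congr 1; ring
      rw [e]; ring
  refine hdom.mono' ?_ ?_
  · exact (Measurable.mul (by fun_prop) (measurable_fracHeatKernel n s)).aestronglyMeasurable
  · filter_upwards [ae_lagMeasure_pos n] with ⟨τ, y⟩ hτ
    simp only [fracHeatKernel] at hτ ⊢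
    rw [Real.norm_of_nonneg (by positivity)]
    have hexp : Real.exp (-‖y‖ ^ 2 / (4 * τ)) ≤ Real.exp (-(1 / (8 * τ)) * ‖y‖ ^ 2) := by
      rw [Real.exp_le_exp]
      have : -(1 / (8 * τ)) * ‖y‖ ^ 2 - -‖y‖ ^ 2 / (4 * τ) = ‖y‖ ^ 2 / (8 * τ) := by
        field_simp; ring
      have : 0 ≤ ‖y‖ ^ 2 / (8 * τ) := by positivity
      linarith
    have key : min 1 (‖y‖ ^ 2 + τ) * Real.exp (-‖y‖ ^ 2 / (4 * τ))
        ≤ min 1 (9 * τ) * Real.exp (-(1 / (8 * τ)) * ‖y‖ ^ 2) := by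
      rw [min_mul_of_nonneg _ _ (Real.exp_nonneg _), min_mul_of_nonneg _ _ (Real.exp_nonneg _)]
      refine min_le_min (by simpa using hexp) ?_
      have := sq_mul_exp_neg_le (r := ‖y‖) hτ
      nlinarith
    calc _ = τ ^ (-((n : ℝ) / 2 + 1 + s)) *
          (min 1 (‖y‖ ^ 2 + τ) * Real.exp (-‖y‖ ^ 2 / (4 * τ))) := by ring
      _ ≤ τ ^ (-((n : ℝ) / 2 + 1 + s)) *
          (min 1 (9 * τ) * Real.exp (-(1 / (8 * τ)) * ‖y‖ ^ 2)) := by gcongr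
      _ = _ := by ring

section Pairing

variable {n : ℕ} {s : ℝ} (σ : ℝ) (f : SchwartzMap (En n × ℝ) ℂ)

theorem integrable_heatDifference_mul_kernel (hs0 : 0 < s) (hs1 : s < 1) (p : En n × ℝ) :
    Integrable (fun z => heatDifference σ f p z * (fracHeatKernel n s z : ℂ))
      (lagMeasure n) := by
  obtain ⟨C, hC, h⟩ := exists_norm_heatDifference_le σ f
  refine ((integrable_min_mul_fracHeatKernel n hs0 hs1).const_mul C).mono' ?_ ?_
  · refine AEStronglyMeasurable.mul ?_
      (Complex.measurable_ofReal.comp (measurable_fracHeatKernel n s)).aestronglyMeasurable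
    have := f.continuous
    unfold heatDifference
    exact Continuous.aestronglyMeasurable (by fun_prop)
  · filter_upwards [ae_lagMeasure_pos n] with z hz
    have hk : 0 ≤ fracHeatKernel n s z := by unfold fracHeatKernel; positivity
    rw [norm_mul, Complex.norm_real, Real.norm_of_nonneg hk, ← mul_assoc]
    gcongr
    exact h p z hz

theorem integrable_mul_heatDifference_mul_kernel (hs0 : 0 < s) (hs1 : s < 1)
    {g : En n × ℝ → ℂ} (hg : Integrable g) :
    Integrable (fun q : (En n × ℝ) × (ℝ × En n) =>
      g q.1 * (heatDifference σ f q.1 q.2 * (fracHeatKernel n s q.2 : ℂ)))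
      (volume.prod (lagMeasure n)) := by
  obtain ⟨C, hC, h⟩ := exists_norm_heatDifference_le σ f
  refine (hg.norm.mul_prod
    ((integrable_min_mul_fracHeatKernel n hs0 hs1).const_mul C)).mono' ?_ ?_
  · refine hg.aestronglyMeasurable.comp_fst.mul (AEStronglyMeasurable.mul ?_
      (Complex.measurable_ofReal.comp
        ((measurable_fracHeatKernel n s).comp measurable_snd)).aestronglyMeasurable)
    have := f.continuous
    unfold heatDifference
    exact Continuous.aestronglyMeasurable (by fun_prop)
  · filter_upwards [Measure.quasiMeasurePreserving_snd.ae (ae_lagMeasure_pos n)] with q hq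
    have hk : 0 ≤ fracHeatKernel n s q.2 := by unfold fracHeatKernel; positivity
    rw [norm_mul, norm_mul, Complex.norm_real, Real.norm_of_nonneg hk, ← mul_assoc C]
    gcongr
    exact h q.1 q.2 hq

theorem leftHeat_eq (hs0 : 0 < s) (hs1 : s < 1) (p : En n × ℝ) :
    leftHeat n s (fun q => f q) p.1 p.2 = ((Cns n s / 2 : ℝ) : ℂ) *
      ∫ z, heatDifference (-1) f p z * (fracHeatKernel n s z : ℂ) ∂lagMeasure n := by
  rw [lagMeasure, integral_prod _ (integrable_heatDifference_mul_kernel (-1) f hs0 hs1 p)]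
  simp [leftHeat, heatDifference, fracHeatKernel, sub_eq_add_neg]

theorem rightHeat_eq (hs0 : 0 < s) (hs1 : s < 1) (p : En n × ℝ) :
    rightHeat n s (fun q => f q) p.1 p.2 = ((Cns n s / 2 : ℝ) : ℂ) *
      ∫ z, heatDifference 1 f p z * (fracHeatKernel n s z : ℂ) ∂lagMeasure n := by
  rw [lagMeasure, integral_prod _ (integrable_heatDifference_mul_kernel 1 f hs0 hs1 p)]
  simp [rightHeat, heatDifference, fracHeatKernel]

theorem integrable_mul_integral_heatDifference (hs0 : 0 < s) (hs1 : s < 1)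
    {g : En n × ℝ → ℂ} (hg : Integrable g) :
    Integrable (fun p => g p *
      ∫ z, heatDifference σ f p z * (fracHeatKernel n s z : ℂ) ∂lagMeasure n) := by
  simpa only [integral_const_mul] using
    (integrable_mul_heatDifference_mul_kernel σ f hs0 hs1 hg).integral_prod_left

theorem integral_mul_integral_heatDifference (hs0 : 0 < s) (hs1 : s < 1)
    {g : En n × ℝ → ℂ} (hg : Integrable g) :
    ∫ p, g p * ∫ z, heatDifference σ f p z * (fracHeatKernel n s z : ℂ) ∂lagMeasure n =
      ∫ z, (∫ p, g p * heatDifference σ f p z) * (fracHeatKernel n s z : ℂ) ∂lagMeasure n := by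
  simp only [← integral_const_mul, ← integral_mul_const, mul_assoc]
  exact integral_integral_swap (integrable_mul_heatDifference_mul_kernel σ f hs0 hs1 hg)

end Pairing

theorem integral_mul_comp_sub_eq {G : Type*} [AddCommGroup G] [MeasurableSpace G]
    [MeasurableAdd G] {μ : Measure G} [μ.IsAddRightInvariant] (g h : G → ℂ) (v : G) :
    ∫ p, g p * h (p - v) ∂μ = ∫ p, h p * g (p + v) ∂μ := by
  rw [← integral_add_right_eq_self (fun p => g p * h (p - v)) v]
  simp [mul_comm]

theorem integral_conj_mul_heatDifference {n : ℕ} (u φ : SchwartzMap (En n × ℝ) ℂ)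
    (z : ℝ × En n) :
    ∫ p, (starRingEnd ℂ) (φ p) * heatDifference (-1) u p z =
      ∫ p, u p * (starRingEnd ℂ) (heatDifference 1 φ p z) := by
  obtain ⟨τ, y⟩ := z
  set ψ : En n × ℝ → ℂ := fun p => (starRingEnd ℂ) (φ p) with hψ
  have hψi : Integrable ψ := integrable_conj_schwartz φ
  have hi : ∀ {a b : En n × ℝ → ℂ}, Integrable a → Continuous b → (∃ C, ∀ p, ‖b p‖ ≤ C) →
      Integrable (fun p => a p * b p) := fun ha hb ⟨C, hC⟩ =>
    ha.mul_bdd hb.aestronglyMeasurable (.of_forall hC)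
  obtain ⟨A, -, hA⟩ := u.exists_norm_le
  obtain ⟨B, -, hB⟩ := φ.exists_norm_le
  have cu := u.continuous
  have cψ : Continuous ψ := Complex.continuous_conj.comp φ.continuous
  have hBψ : ∀ p, ‖ψ p‖ ≤ B := fun p => by simpa [hψ] using hB p
  have l : ∀ p, ψ p * heatDifference (-1) u p (τ, y)
      = 2 * (u p * ψ p) - ψ p * u (p - (-y, τ)) - ψ p * u (p - (y, τ)) := by
    rintro ⟨x, t⟩
    simp only [heatDifference, Prod.mk_sub_mk, sub_neg_eq_add, neg_one_mul, ← sub_eq_add_neg]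
    ring
  have r : ∀ p, u p * (starRingEnd ℂ) (heatDifference 1 φ p (τ, y))
      = 2 * (u p * ψ p) - u p * ψ (p + (-y, τ)) - u p * ψ (p + (y, τ)) := by
    rintro ⟨x, t⟩
    simp only [heatDifference, hψ, Prod.mk_add_mk, one_mul, ← sub_eq_add_neg, map_sub, map_mul,
      Complex.conj_ofNat]
    ring
  have i0 : Integrable (fun p => 2 * (u p * ψ p)) :=
    (hi u.integrable cψ ⟨B, hBψ⟩).const_mul 2
  have il : ∀ v, Integrable (fun p => ψ p * u (p - v)) := fun v =>
    hi hψi (by fun_prop) ⟨A, fun p => hA _⟩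
  have ir : ∀ v, Integrable (fun p => u p * ψ (p + v)) := fun v =>
    hi u.integrable (by fun_prop) ⟨B, fun p => hBψ _⟩
  change ∫ p, ψ p * heatDifference (-1) u p (τ, y) = _
  simp only [l, r]
  have split : ∀ {a b c : En n × ℝ → ℂ}, Integrable a → Integrable b → Integrable c →
      ∫ p, a p - b p - c p = (∫ p, a p) - (∫ p, b p) - ∫ p, c p := fun {a b c} ha hb hc => by
    rw [integral_sub (f := fun p => a p - b p) (ha.sub hb) hc, integral_sub ha hb]
  rw [split i0 (il _) (il _), split i0 (ir _) (ir _),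
    integral_mul_comp_sub_eq, integral_mul_comp_sub_eq]

/-- Duality between the left and right fully fractional heat operators on Schwartz
functions: `∫∫ (∂_t−Δ)^s u · conj φ = ∫∫ u · conj((∂_t−Δ)^s_{right} φ)`, both integrals
being absolutely convergent. -/
theorem leftHeat_rightHeat_duality (n : ℕ) (hn : 1 ≤ n)
    (s : ℝ) (hs0 : 0 < s) (hs1 : s < 1)
    (u φ : SchwartzMap (En n × ℝ) ℂ) :
    Integrable (fun p : En n × ℝ =>
      leftHeat n s (fun q => u q) p.1 p.2 * (starRingEnd ℂ) (φ p)) volume ∧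
    Integrable (fun p : En n × ℝ =>
      u p * (starRingEnd ℂ) (rightHeat n s (fun q => φ q) p.1 p.2)) volume ∧
    (∫ t : ℝ, ∫ x : En n,
        leftHeat n s (fun q => u q) x t * (starRingEnd ℂ) (φ (x, t))) =
      ∫ t : ℝ, ∫ x : En n,
        u (x, t) * (starRingEnd ℂ) (rightHeat n s (fun q => φ q) x t) := by
  have hφ : Integrable (fun p => (starRingEnd ℂ) (φ p)) := integrable_conj_schwartz φ
  set c : ℂ := ((Cns n s / 2 : ℝ) : ℂ) with hc
  have hl : ∀ p, leftHeat n s (fun q => u q) p.1 p.2 * (starRingEnd ℂ) (φ p) =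
      c * ((starRingEnd ℂ) (φ p) *
        ∫ z, heatDifference (-1) u p z * (fracHeatKernel n s z : ℂ) ∂lagMeasure n) := fun p => by
    rw [leftHeat_eq u hs0 hs1 p]; ring
  have hr : ∀ p, u p * (starRingEnd ℂ) (rightHeat n s (fun q => φ q) p.1 p.2) =
      (starRingEnd ℂ) (c * ((starRingEnd ℂ) (u p) *
        ∫ z, heatDifference 1 φ p z * (fracHeatKernel n s z : ℂ) ∂lagMeasure n)) := fun p => by
    rw [rightHeat_eq φ hs0 hs1 p]; simp only [map_mul, Complex.conj_conj]; ring
  have hu : Integrable (fun p => (starRingEnd ℂ) (u p)) := integrable_conj_schwartz u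
  have hL : Integrable (fun p : En n × ℝ =>
      leftHeat n s (fun q => u q) p.1 p.2 * (starRingEnd ℂ) (φ p)) volume := by
    simp only [hl]
    exact (integrable_mul_integral_heatDifference (-1) u hs0 hs1 hφ).const_mul c
  have hR : Integrable (fun p : En n × ℝ =>
      u p * (starRingEnd ℂ) (rightHeat n s (fun q => φ q) p.1 p.2)) volume := by
    simp only [hr]
    rw [← memLp_one_iff_integrable]
    exact (memLp_one_iff_integrable.2
      ((integrable_mul_integral_heatDifference 1 φ hs0 hs1 hu).const_mul c)).star
  refine ⟨hL, hR, ?_⟩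
  rw [← integral_prod_symm _ hL, ← integral_prod_symm _ hR, ← Measure.volume_eq_prod]
  simp only [hl, hr]
  rw [integral_conj, integral_const_mul, integral_const_mul,
    integral_mul_integral_heatDifference (-1) u hs0 hs1 hφ,
    integral_mul_integral_heatDifference 1 φ hs0 hs1 hu, map_mul, hc, Complex.conj_ofReal,
    ← integral_conj]
  simp only [integral_conj_mul_heatDifference, map_mul, ← integral_conj, Complex.conj_conj,
    Complex.conj_ofReal]
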